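/- Let X be a set carrying two abstract crystal structures (e_i, f_i, ε_i, φ_i, wt) and (e_i^⋆, f_i^⋆, ε_i^⋆, φ_i^⋆, wt) with the same weight function, and let b_0 ∈ X satisfy e_i b_0 = e_i^⋆ b_0 = 0 for all i ∈ I and wt(b_0) = 0. Let B ⊆ X be the set generated from b_0 by the operators f_i and B^⋆ ⊆ X the set generated from b_0 by the operators f_i^⋆. For b ∈ X set κ_i(b) = ε_i(b) + ε_i^⋆(b) + ⟨h_i, wt(b)⟩. Assume for all i ≠ j in I and all b ∈ X: (1) f_i b ≠ 0 and f_i^⋆ b ≠ 0; (2) f_i^⋆ f_j b = f_j f_i^⋆ b; (3) κ_i(b) ≥ 0; (4) κ_i(b) = 0 implies f_i b = f_i^⋆ b; (5) κ_i(b) ≥ 1 implies ε_i^⋆(f_i b) = ε_i^⋆(b) and ε_i(f_i^⋆ b) = ε_i(b); (6) κ_i(b) ≥ 2 implies f_i f_i^⋆ b = f_i^⋆ f_i b. Then B = B^⋆. -/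

import Mathlib

/-- Iterate a partial operator `k` times. -/
def iterOpt {X : Type*} (g : X → Option X) : ℕ → X → Option X
  | 0, x => some x
  | k + 1, x => (iterOpt g k x).bind g

/-- An abstract crystal structure on a set `X`, with weight lattice `P`, simple roots
`α i` and pairings `pair i = ⟨h_i, ·⟩`.  The operators `e i`, `f i` take values in
`Option X`, with `none` playing the role of `0`. -/
structure AbstractCrystal (I X P : Type*) [AddCommGroup P]
    (α : I → P) (pair : I → P →+ ℤ) where
  e : I → X → Option X
  f : I → X → Option X
  eps : I → X → ℤ
  phi : I → X → ℤ
  wt : X → P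
  phi_eq : ∀ i b, phi i b = eps i b + pair i (wt b)
  wt_f : ∀ i b b', f i b = some b' → wt b' = wt b - α i
  eps_f : ∀ i b b', f i b = some b' → eps i b' = eps i b + 1
  phi_f : ∀ i b b', f i b = some b' → phi i b' = phi i b - 1
  f_iff_e : ∀ i b b', (f i b = some b' ↔ e i b' = some b)
  eps_spec : ∀ i b, eps i b = ((sSup {k : ℕ | iterOpt (e i) k b ≠ none} : ℕ) : ℤ)

/-- The subset of `X` generated from `b0` by the partial operators `f i`, `i ∈ I`. -/
def genSet {I X : Type*} (f : I → X → Option X) (b0 : X) : Set X :=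
  {b | ∃ l : List I, l.foldl (fun o i => o.bind (f i)) (some b0) = some b}

theorem iterOpt_succ_eq_none {X : Type*} {g : X → Option X} {x : X} (h : g x = none) (k : ℕ) :
    iterOpt g (k + 1) x = none := by
  induction k with
  | zero => simpa [iterOpt] using h
  | succ k ih => rw [iterOpt, ih, Option.bind_none]

theorem mem_genSet_self {I X : Type*} (f : I → X → Option X) (b0 : X) : b0 ∈ genSet f b0 :=
  ⟨[], rfl⟩

theorem mem_genSet_of_apply {I X : Type*} {f : I → X → Option X} {b0 b b' : X} {i : I}
    (hb : b ∈ genSet f b0) (h : f i b = some b') : b' ∈ genSet f b0 := by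
  obtain ⟨l, hl⟩ := hb
  exact ⟨l ++ [i], by simp [List.foldl_append, hl, h]⟩

/-- A set containing `b0` and closed under the operators `f i` contains `genSet f b0`. -/
theorem genSet_subset {I X : Type*} {f : I → X → Option X} {b0 : X} {S : Set X} (h0 : b0 ∈ S)
    (hf : ∀ i, ∀ b ∈ genSet f b0, b ∈ S → ∀ b', f i b = some b' → b' ∈ S) :
    genSet f b0 ⊆ S := by
  rintro b ⟨l, hl⟩
  induction l using List.reverseRecOn generalizing b with
  | nil => simp_all
  | append_singleton l i ih =>
    rw [List.foldl_append, List.foldl_cons, List.foldl_nil, Option.bind_eq_some_iff] at hl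
    obtain ⟨c, hc, hcb⟩ := hl
    exact hf i c ⟨l, hc⟩ (ih hc) b hcb

namespace AbstractCrystal

variable {I X P : Type*} [AddCommGroup P] {α : I → P} {pair : I → P →+ ℤ}

theorem eps_eq_zero (C : AbstractCrystal I X P α pair) {i : I} {b : X} (h : C.e i b = none) :
    C.eps i b = 0 := by
  have hset : {k : ℕ | iterOpt (C.e i) k b ≠ none} = {0} := by
    ext k
    cases k with
    | zero => simp [iterOpt]
    | succ k => simp [iterOpt_succ_eq_none h]
  rw [C.eps_spec, hset, csSup_singleton, Nat.cast_zero]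

theorem pair_wt_f (C : AbstractCrystal I X P α pair) {i : I} {b b' : X}
    (h : C.f i b = some b') : pair i (C.wt b') = pair i (C.wt b) - 2 := by
  have := C.phi_eq i b
  have := C.phi_eq i b'
  have := C.eps_f i b b' h
  have := C.phi_f i b b' h
  lia

/-- Under the Tingley–Webster conditions, the set generated by the `f i` absorbs the set generated
by the `f⋆ i`. -/
theorem genSet_star_subset (C Cs : AbstractCrystal I X P α pair)
    (b0 : X) (hb0e : ∀ i, C.e i b0 = none) (hb0es : ∀ i, Cs.e i b0 = none)
    (hwt0 : C.wt b0 = 0)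
    (kappa : I → X → ℤ)
    (hkappa : ∀ i b, kappa i b = C.eps i b + Cs.eps i b + pair i (C.wt b))
    (h1 : ∀ (i : I) (b : X), Cs.f i b ≠ none)
    (h2 : ∀ (i j : I), i ≠ j → ∀ b : X,
      (C.f j b).bind (Cs.f i) = (Cs.f i b).bind (C.f j))
    (h3 : ∀ (i : I) (b : X), 0 ≤ kappa i b)
    (h4 : ∀ (i : I) (b : X), kappa i b = 0 → C.f i b = Cs.f i b)
    (h5 : ∀ (i : I) (b : X), 1 ≤ kappa i b → ∀ b', C.f i b = some b' → Cs.eps i b' = Cs.eps i b)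
    (h6 : ∀ (i : I) (b : X), 2 ≤ kappa i b →
      (Cs.f i b).bind (C.f i) = (C.f i b).bind (Cs.f i)) :
    genSet Cs.f b0 ⊆ genSet C.f b0 := by
  have closed : genSet C.f b0 ⊆ {b | ∀ i b', Cs.f i b = some b' → b' ∈ genSet C.f b0} := by
    refine genSet_subset (fun i b' hb' => ?_) fun j c hcB hc b hb i b' hb' => ?_
    · have hk : kappa i b0 = 0 := by
        rw [hkappa, C.eps_eq_zero (hb0e i), Cs.eps_eq_zero (hb0es i), hwt0, map_zero]
        rfl
      exact mem_genSet_of_apply (mem_genSet_self _ _) ((h4 i b0 hk).trans hb')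
    · have of_comm (hcomm : (C.f j c).bind (Cs.f i) = (Cs.f i c).bind (C.f j)) :
          b' ∈ genSet C.f b0 := by
        obtain ⟨d, hd⟩ := Option.ne_none_iff_exists'.mp (h1 i c)
        rw [hb, hd, Option.bind_some, Option.bind_some, hb'] at hcomm
        exact mem_genSet_of_apply (hc i d hd) hcomm.symm
      by_cases hij : i = j
      · subst hij
        by_cases hk2 : 2 ≤ kappa i c
        · exact of_comm (h6 i c hk2).symm
        · have hkb : kappa i b = 0 := by
            have hκc := hkappa i c
            have hκb := hkappa i b
            have hp := C.pair_wt_f hb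
            have he := C.eps_f i c b hb
            have hnonneg := h3 i c
            by_cases hk0 : kappa i c = 0
            · have hes := Cs.eps_f i c b ((h4 i c hk0).symm.trans hb)
              lia
            · have hes := h5 i c (by lia) b hb
              lia
          exact mem_genSet_of_apply (mem_genSet_of_apply hcB hb) ((h4 i b hkb).trans hb')
      · exact of_comm (h2 i j hij c)
  exact genSet_subset (mem_genSet_self _ _) fun i b _ hb b' hb' => closed hb i b' hb'

end AbstractCrystal

/-- given two abstract crystal structures on a set `X` with the same weight
function and a common highest weight element `b0` of weight `0`, satisfying the
Tingley–Webster conditions (1)–(6), the set `B` generated from `b0` by the operators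
`f i` coincides with the set `B⋆` generated from `b0` by the operators `f⋆ i`. -/
theorem statement15 {I X P : Type*} [AddCommGroup P] (α : I → P) (pair : I → P →+ ℤ)
    (C Cs : AbstractCrystal I X P α pair) (hwt : C.wt = Cs.wt)
    (b0 : X) (hb0e : ∀ i, C.e i b0 = none) (hb0es : ∀ i, Cs.e i b0 = none)
    (hwt0 : C.wt b0 = 0)
    (kappa : I → X → ℤ)
    (hkappa : ∀ i b, kappa i b = C.eps i b + Cs.eps i b + pair i (C.wt b))
    (h1 : ∀ (i : I) (b : X), C.f i b ≠ none ∧ Cs.f i b ≠ none)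
    (h2 : ∀ (i j : I), i ≠ j → ∀ b : X,
      (C.f j b).bind (Cs.f i) = (Cs.f i b).bind (C.f j))
    (h3 : ∀ (i : I) (b : X), 0 ≤ kappa i b)
    (h4 : ∀ (i : I) (b : X), kappa i b = 0 → C.f i b = Cs.f i b)
    (h5 : ∀ (i : I) (b : X), 1 ≤ kappa i b →
      (∀ b', C.f i b = some b' → Cs.eps i b' = Cs.eps i b) ∧
      (∀ b', Cs.f i b = some b' → C.eps i b' = C.eps i b))
    (h6 : ∀ (i : I) (b : X), 2 ≤ kappa i b →
      (Cs.f i b).bind (C.f i) = (C.f i b).bind (Cs.f i)) :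
    genSet C.f b0 = genSet Cs.f b0 := by
  refine (AbstractCrystal.genSet_star_subset Cs C b0 hb0es hb0e (hwt ▸ hwt0) kappa
    (fun i b => by rw [hkappa, hwt, add_comm (C.eps i b)]) (fun i b => (h1 i b).1)
    (fun i j hij b => (h2 j i hij.symm b).symm) h3 (fun i b h => (h4 i b h).symm)
    (fun i b h => (h5 i b h).2) (fun i b h => (h6 i b h).symm)).antisymm
    (AbstractCrystal.genSet_star_subset C Cs b0 hb0e hb0es hwt0 kappa hkappa
      (fun i b => (h1 i b).2) h2 h3 h4 (fun i b h => (h5 i b h).1) h6)
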